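/- For every u ∈ F, the Borel measure μ on K determined by μ(K_w) = (1/R_{|w|}) · E^{𝒍^{|w|}}(u∘F_w, u∘F_w) for every w ∈ W_* (the E-energy measure of u) is singular with respect to m: there is a Borel set A ⊆ K with μ(A) = 0 and m(K ∖ A) = 0. -/

import Mathlib

open scoped BigOperators ENNReal
open Set Filter MeasureTheory

noncomputable section

abbrev E2 : Type := EuclideanSpace ℝ (Fin 2)

/-- The index set `S_l` of the level-`l` thin Sierpinski gasket. -/
def Sset (l : ℕ) : Set (ℕ × ℕ) :=
  {p | p.1 + p.2 ≤ l - 1 ∧ p.1 * p.2 * (l - 1 - p.1 - p.2) = 0}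

/-- The contraction `f^l_i`. -/
def fmap (q : Fin 3 → E2) (l : ℕ) (i : ℕ × ℕ) (x : E2) : E2 :=
  q 0 + ((i.1 : ℝ) / l) • (q 1 - q 0) + ((i.2 : ℝ) / l) • (q 2 - q 0)
    + (l : ℝ)⁻¹ • (x - q 0)

/-- The closed equilateral triangle `△`. -/
def Tri (q : Fin 3 → E2) : Set E2 := convexHull ℝ (Set.range q)

def V0 (q : Fin 3 → E2) : Set E2 := Set.range q

/-- Words of length `n` (padded by `(0,0)` beyond position `n`). -/
def Wn (l : ℕ → ℕ) (n : ℕ) : Set (ℕ → ℕ × ℕ) :=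
  {w | (∀ k, k < n → w k ∈ Sset (l k)) ∧ ∀ k, n ≤ k → w k = (0, 0)}

/-- `wordMap q l w n = f^{l_1}_{w_1} ∘ ⋯ ∘ f^{l_n}_{w_n}` (0-indexed). -/
def wordMap (q : Fin 3 → E2) (l : ℕ → ℕ) (w : ℕ → ℕ × ℕ) : ℕ → E2 → E2
  | 0 => id
  | n + 1 => wordMap q l w n ∘ fmap q (l n) (w n)

/-- The thin scale irregular Sierpinski gasket `K`. -/
def Gasket (q : Fin 3 → E2) (l : ℕ → ℕ) : Set E2 :=
  ⋂ n, ⋃ w ∈ Wn l n, wordMap q l w n '' Tri q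

/-- The cell `K_w = K ∩ f_w(△)`. -/
def Cell (q : Fin 3 → E2) (l : ℕ → ℕ) (n : ℕ) (w : ℕ → ℕ × ℕ) : Set E2 :=
  Gasket q l ∩ wordMap q l w n '' Tri q

def Vn (q : Fin 3 → E2) (l : ℕ → ℕ) (n : ℕ) : Set E2 :=
  ⋃ w ∈ Wn l n, wordMap q l w n '' V0 q

def Vstar (q : Fin 3 → E2) (l : ℕ → ℕ) : Set E2 := ⋃ n, Vn q l n

def Ln (l : ℕ → ℕ) (n : ℕ) : ℕ := ∏ k ∈ Finset.range n, l k

def Mn (l : ℕ → ℕ) (n : ℕ) : ℕ := ∏ k ∈ Finset.range n, (3 * l k - 3)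

def rl (l : ℕ) : ℝ := (2 * (l : ℝ) / 3 + 1 / 9)⁻¹

def Rn (l : ℕ → ℕ) (n : ℕ) : ℝ := ∏ k ∈ Finset.range n, rl (l k)

def Tn (l : ℕ → ℕ) (n : ℕ) : ℝ := (Mn l n : ℝ) / Rn l n

/-- The basic energy form `E⁰` on `ℝ^{V₀}`. -/
def E0 (q : Fin 3 → E2) (u v : E2 → ℝ) : ℝ :=
  (1 / 2) * ∑ j : Fin 3, ∑ k : Fin 3, (u (q j) - u (q k)) * (v (q j) - v (q k))

/-- The level-`n` energy form `Eⁿ`. -/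
def En (q : Fin 3 → E2) (l : ℕ → ℕ) (n : ℕ) (u v : E2 → ℝ) : ℝ :=
  (Rn l n)⁻¹ * ∑ᶠ w ∈ Wn l n, E0 q (u ∘ wordMap q l w n) (v ∘ wordMap q l w n)

/-- The domain `F` of the limit resistance form. -/
def FDom (q : Fin 3 → E2) (l : ℕ → ℕ) : Set (E2 → ℝ) :=
  {u | ∃ C : ℝ, ∀ n, En q l n u u ≤ C}

/-- The limit form `E(u,v) = lim_n Eⁿ(u,v)`. -/
def EForm (q : Fin 3 → E2) (l : ℕ → ℕ) (u v : E2 → ℝ) : ℝ :=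
  limUnder atTop fun n => En q l n u v

/-- The intrinsic (geodesic) distance on `K`, with values in `ℝ≥0∞`. -/
def pdist (q : Fin 3 → E2) (l : ℕ → ℕ) (x y : E2) : ℝ≥0∞ :=
  ⨅ (γ : ℝ → E2) (_ : ContinuousOn γ (Set.Icc 0 1))
    (_ : Set.MapsTo γ (Set.Icc 0 1) (Gasket q l)) (_ : γ 0 = x) (_ : γ 1 = y),
    eVariationOn γ (Set.Icc 0 1)

def gdist (q : Fin 3 → E2) (l : ℕ → ℕ) (x y : E2) : ℝ := (pdist q l x y).toReal

/-- The set of resistance quotients used to define `R_E`. -/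
def REset (q : Fin 3 → E2) (l : ℕ → ℕ) (x y : E2) : Set ℝ :=
  {t | ∃ u ∈ FDom q l, 0 < EForm q l u u ∧ t = (u x - u y) ^ 2 / EForm q l u u}

/-- The resistance metric `R_E`. -/
def RE (q : Fin 3 → E2) (l : ℕ → ℕ) (x y : E2) : ℝ := sSup (REset q l x y)

/-- Resistance quotients over continuous representatives (i.e. `F` viewed in `C(K)`). -/
def REcSet (q : Fin 3 → E2) (l : ℕ → ℕ) (x y : E2) : Set ℝ :=
  {t | ∃ u ∈ FDom q l, ContinuousOn u (Gasket q l) ∧ 0 < EForm q l u u ∧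
    t = (u x - u y) ^ 2 / EForm q l u u}

def REc (q : Fin 3 → E2) (l : ℕ → ℕ) (x y : E2) : ℝ := sSup (REcSet q l x y)

/-- The open `d`-ball in `K`. -/
def Bd (q : Fin 3 → E2) (l : ℕ → ℕ) (x : E2) (s : ℝ) : Set E2 :=
  {y ∈ Gasket q l | gdist q l x y < s}

/-- The open `R_E`-ball in `K`. -/
def BRc (q : Fin 3 → E2) (l : ℕ → ℕ) (x : E2) (s : ℝ) : Set E2 :=
  {y ∈ Gasket q l | REc q l x y < s}

/-- `Λ^{(k)}_{n,w}`: words within `k` cell-steps of `w`. -/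
def Lam (q : Fin 3 → E2) (l : ℕ → ℕ) (n : ℕ) (w : ℕ → ℕ × ℕ) (k : ℕ) :
    Set (ℕ → ℕ × ℕ) :=
  {v ∈ Wn l n | ∃ c : ℕ → ℕ → ℕ × ℕ, c 0 = w ∧ c k = v ∧ (∀ j ≤ k, c j ∈ Wn l n) ∧
    ∀ j < k, (Cell q l n (c j) ∩ Cell q l n (c (j + 1))).Nonempty}

/-- `U^{(k)}_{n,w}`. -/
def Unwk (q : Fin 3 → E2) (l : ℕ → ℕ) (n : ℕ) (w : ℕ → ℕ × ℕ) (k : ℕ) : Set E2 :=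
  ⋃ v ∈ Lam q l n w k, Cell q l n v

def betaZero (l : ℕ → ℕ) : ℝ :=
  ⨅ n : ℕ, Real.logb (l n) (2 * (l n : ℝ) ^ 2 - (5 / 3) * (l n : ℝ) - 1 / 3)

def betaOne (l : ℕ → ℕ) : ℝ :=
  ⨆ n : ℕ, Real.logb (l n) (2 * (l n : ℝ) ^ 2 - (5 / 3) * (l n : ℝ) - 1 / 3)

def betaM (l : ℕ → ℕ) : ℝ := ⨅ n : ℕ, Real.logb (l n) (3 * (l n : ℝ) - 3)

def betaR (l : ℕ → ℕ) : ℝ := ⨆ n : ℕ, Real.logb (l n) ((rl (l n))⁻¹)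

/-- The value of `Ψ` on the interval `[1/L_{n+1}, 1/L_n]`. -/
def psiPiece (l : ℕ → ℕ) (n : ℕ) (s : ℝ) : ℝ :=
  (Tn l (n + 1))⁻¹
    * (1 + ((3 * (l n : ℝ) - 4) / ((l n : ℝ) - 1)) * ((Ln l (n + 1) : ℝ) * s - 1))
    * (1 + (((2 / 3) * (l n : ℝ) - 8 / 9) / ((l n : ℝ) - 1)) * ((Ln l (n + 1) : ℝ) * s - 1))

/-- `Ψ = Ψ_𝒍` is characterized by these defining clauses. -/
def IsPsi (l : ℕ → ℕ) (Psi : ℝ → ℝ) : Prop :=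
  (∀ n : ℕ, ∀ s : ℝ, ((Ln l (n + 1) : ℝ))⁻¹ ≤ s → s ≤ ((Ln l n : ℝ))⁻¹ →
      Psi s = psiPiece l n s) ∧
  (∀ s : ℝ, 1 ≤ s → Psi s = s ^ betaZero l) ∧ Psi 0 = 0

def psiMPiece (l : ℕ → ℕ) (n : ℕ) (s : ℝ) : ℝ :=
  ((Mn l (n + 1) : ℝ))⁻¹
    * (1 + ((3 * (l n : ℝ) - 4) / ((l n : ℝ) - 1)) * ((Ln l (n + 1) : ℝ) * s - 1))

def IsPsiM (l : ℕ → ℕ) (PsiM : ℝ → ℝ) : Prop :=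
  (∀ n : ℕ, ∀ s : ℝ, ((Ln l (n + 1) : ℝ))⁻¹ ≤ s → s ≤ ((Ln l n : ℝ))⁻¹ →
      PsiM s = psiMPiece l n s) ∧
  (∀ s : ℝ, 1 ≤ s → PsiM s = s ^ betaM l) ∧ PsiM 0 = 0

def psiRPiece (l : ℕ → ℕ) (n : ℕ) (s : ℝ) : ℝ :=
  Rn l (n + 1)
    * (1 + (((2 / 3) * (l n : ℝ) - 8 / 9) / ((l n : ℝ) - 1)) * ((Ln l (n + 1) : ℝ) * s - 1))

def IsPsiR (l : ℕ → ℕ) (PsiR : ℝ → ℝ) : Prop :=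
  (∀ n : ℕ, ∀ s : ℝ, ((Ln l (n + 1) : ℝ))⁻¹ ≤ s → s ≤ ((Ln l n : ℝ))⁻¹ →
      PsiR s = psiRPiece l n s) ∧
  (∀ s : ℝ, 1 ≤ s → PsiR s = s ^ betaR l) ∧ PsiR 0 = 0

/-- `μ` is the uniform distribution on `K`: a Borel measure carried by `K`
with `μ(K_w) = 1/M_{|w|}` for every word `w`. -/
def IsUnif (q : Fin 3 → E2) (l : ℕ → ℕ) (μ : Measure E2) : Prop :=
  μ (Gasket q l)ᶜ = 0 ∧ ∀ n : ℕ, ∀ w ∈ Wn l n, μ (Cell q l n w) = ((Mn l n : ℝ≥0∞))⁻¹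

/-- `μ` is the energy measure of `u`: a Borel measure carried by `K` with
`μ(K_w) = R_{|w|}⁻¹ E^{𝒍^{|w|}}(u∘F_w, u∘F_w)` for every word `w`. -/
def IsEnergyMeasure (q : Fin 3 → E2) (l : ℕ → ℕ) (u : E2 → ℝ) (μ : Measure E2) : Prop :=
  μ (Gasket q l)ᶜ = 0 ∧ ∀ n : ℕ, ∀ w ∈ Wn l n,
    μ (Cell q l n w) = ENNReal.ofReal ((Rn l n)⁻¹ *
      EForm q (fun k => l (k + n)) (u ∘ wordMap q l w n) (u ∘ wordMap q l w n))


/-! ### Local (one-cell) analysis -/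

/-- Quadratic form of the triangle graph. -/
def TQ (a : Fin 3 → ℝ) : ℝ := (a 0 - a 1) ^ 2 + (a 1 - a 2) ^ 2 + (a 0 - a 2) ^ 2

/-- Bilinear form of the triangle graph. -/
def TB (a b : Fin 3 → ℝ) : ℝ :=
  (a 0 - a 1) * (b 0 - b 1) + (a 1 - a 2) * (b 1 - b 2) + (a 0 - a 2) * (b 0 - b 2)

theorem TQ_nonneg (a : Fin 3 → ℝ) : 0 ≤ TQ a := by unfold TQ; positivity

theorem TQ_sub (a b : Fin 3 → ℝ) : TQ (a - b) = TQ a - 2 * TB b a + TQ b := by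
  simp only [TQ, TB, Pi.sub_apply]; ring

theorem E0_eq (q : Fin 3 → E2) (g : E2 → ℝ) : E0 q g g = TQ (g ∘ q) := by
  simp only [E0, TQ, Fin.sum_univ_three, Function.comp]; ring

theorem sqrt_TQ_le (a b : Fin 3 → ℝ) : √(TQ a) ≤ √(TQ b) + √(TQ (a - b)) := by
  have hb := TQ_nonneg b
  have hd := TQ_nonneg (a - b)
  have h1 := Real.sq_sqrt hb
  have h2 := Real.sq_sqrt hd
  apply Real.sqrt_le_iff.mpr
  refine ⟨by positivity, ?_⟩
  have key : TB b (a - b) ≤ √(TQ b) * √(TQ (a - b)) := by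
    rw [← Real.sqrt_mul hb]
    apply Real.le_sqrt_of_sq_le
    generalize a - b = d
    simp only [TB, TQ]
    nlinarith [sq_nonneg ((b 0 - b 1) * (d 1 - d 2) - (b 1 - b 2) * (d 0 - d 1)),
      sq_nonneg ((b 0 - b 1) * (d 0 - d 2) - (b 0 - b 2) * (d 0 - d 1)),
      sq_nonneg ((b 0 - b 2) * (d 1 - d 2) - (b 1 - b 2) * (d 0 - d 2))]
  have h3 : TQ a = TQ b + 2 * TB b (a - b) + TQ (a - b) := by
    simp only [TQ, TB, Pi.sub_apply]; ring
  nlinarith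

/-- Index type enumerating `S_{n+5}`. -/
abbrev Idx (n : ℕ) : Type := Fin 9 ⊕ (Fin 3 × Fin (n + 1))

/-- Corner cells. -/
def phiC (n : ℕ) : Fin 9 → ℕ × ℕ :=
  ![(0, 0), (1, 0), (0, 1), (n + 4, 0), (n + 3, 0), (n + 3, 1), (0, n + 4), (0, n + 3), (1, n + 3)]

/-- Side cells. -/
def phiS (n : ℕ) (s : Fin 3) (j : ℕ) : ℕ × ℕ :=
  ![(j + 2, 0), (0, j + 2), (n + 2 - j, j + 2)] s

def phi (n : ℕ) : Idx n → ℕ × ℕ :=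
  Sum.elim (phiC n) (fun x => phiS n x.1 x.2)

theorem phi_inj (n : ℕ) : Function.Injective (phi n) := by
  rintro (a | ⟨s, j⟩) (b | ⟨t, k⟩) h
  · have : a = b := by
      fin_cases a <;> fin_cases b <;> simp [phi, phiC] at h ⊢
    rw [this]
  · exfalso
    have hk := k.2
    fin_cases a <;> fin_cases t <;> simp [phi, phiC, phiS, Prod.ext_iff] at h <;> omega
  · exfalso
    have hk := j.2
    fin_cases b <;> fin_cases s <;> simp [phi, phiC, phiS, Prod.ext_iff] at h <;> omega
  · have hk := k.2
    have hj := j.2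
    have : s = t ∧ j.1 = k.1 := by
      fin_cases s <;> fin_cases t <;> simp [phi, phiC, phiS, Prod.ext_iff] at h ⊢ <;> omega
    rw [this.1, Fin.ext this.2]

theorem phi_range (n : ℕ) : Set.range (phi n) = Sset (n + 5) := by
  apply Set.Subset.antisymm
  · rintro _ ⟨(a | ⟨s, j⟩), rfl⟩
    · fin_cases a <;> simp [phi, phiC, Sset] <;> omega
    · have hj := j.2
      fin_cases s <;> simp [phi, phiS, Sset] <;> omega
  · rintro ⟨a, b⟩ ⟨h1, h2⟩
    simp only [mul_eq_zero] at h1 h2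
    have mkC : ∀ i : Fin 9, phiC n i = (a, b) → (a, b) ∈ Set.range (phi n) :=
      fun i hi => ⟨Sum.inl i, hi⟩
    have mkS : ∀ (s : Fin 3) (j : ℕ), j < n + 1 → phiS n s j = (a, b) →
        (a, b) ∈ Set.range (phi n) := fun s j hj hi => ⟨Sum.inr (s, ⟨j, hj⟩), hi⟩
    by_cases c0 : a = 0 ∧ b = 0
    · exact mkC 0 (by simp [phiC, c0])
    by_cases c1 : a = 1 ∧ b = 0
    · exact mkC 1 (by simp [phiC, c1])
    by_cases c2 : a = 0 ∧ b = 1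
    · exact mkC 2 (by simp [phiC, c2])
    by_cases c3 : a = n + 4 ∧ b = 0
    · exact mkC 3 (by simp [phiC, c3])
    by_cases c4 : a = n + 3 ∧ b = 0
    · exact mkC 4 (by simp [phiC, c4])
    by_cases c5 : a = n + 3 ∧ b = 1
    · exact mkC 5 (by simp [phiC, c5])
    by_cases c6 : a = 0 ∧ b = n + 4
    · exact mkC 6 (by simp [phiC, c6])
    by_cases c7 : a = 0 ∧ b = n + 3
    · exact mkC 7 (by simp [phiC, c7])
    by_cases c8 : a = 1 ∧ b = n + 3
    · exact mkC 8 (by simp [phiC, c8])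
    rcases h2 with (h2 | h2) | h2
    · exact mkS 1 (b - 2) (by omega) (by simp [phiS]; omega)
    · exact mkS 0 (a - 2) (by omega) (by simp [phiS]; omega)
    · have hs : a + b = n + 4 := by clear c0 c1 c2 c3 c4 c5 c6 c7 c8; omega
      have b0 : b ≠ 0 := fun h => c3 ⟨by omega, h⟩
      have b1 : b ≠ 1 := fun h => c5 ⟨by omega, h⟩
      have b2 : b ≠ n + 3 := fun h => c8 ⟨by omega, h⟩
      have b3 : b ≠ n + 4 := fun h => c6 ⟨by omega, h⟩
      clear c0 c1 c2 c3 c4 c5 c6 c7 c8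
      exact mkS 2 (b - 2) (by omega) (by simp [phiS]; omega)

theorem Sset_finite (l : ℕ) : (Sset l).Finite := by
  apply ((Set.finite_Iic (l - 1)).prod (Set.finite_Iic (l - 1))).subset
  rintro ⟨a, b⟩ ⟨h1, -⟩
  simp only [Set.mem_prod, Set.mem_Iic] at h1 ⊢
  omega

/-- `S_l` as a finset. -/
def Sf (l : ℕ) : Finset (ℕ × ℕ) := (Sset_finite l).toFinset

theorem sum_Sf (n : ℕ) (f : ℕ × ℕ → ℝ) : ∑ i ∈ Sf (n + 5), f i = ∑ x : Idx n, f (phi n x) := by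
  classical
  have : Sf (n + 5) = Finset.univ.image (phi n) := by
    ext p
    rw [Sf, Set.Finite.mem_toFinset, ← phi_range]
    simp
  rw [this, Finset.sum_image (fun _ _ _ _ h => phi_inj n h)]

theorem card_Sf (l : ℕ) (hl : 5 ≤ l) : (Sf l).card = 3 * l - 3 := by
  classical
  obtain ⟨n, rfl⟩ := Nat.exists_eq_add_of_le' hl
  have : Sf (n + 5) = Finset.univ.image (phi n) := by
    ext p
    rw [Sf, Set.Finite.mem_toFinset, ← phi_range]
    simp
  rw [this, Finset.card_image_of_injective _ (phi_inj n)]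
  simp
  omega

/-- The vertex values of a cell in a grid function. -/
def cv (U : ℕ × ℕ → ℝ) (p : ℕ × ℕ) : Fin 3 → ℝ :=
  ![U p, U (p.1 + 1, p.2), U (p.1, p.2 + 1)]

/-- Harmonic extension on corner cells (mod constants). -/
def HC (r : ℝ) (a : Fin 3 → ℝ) : Fin 9 → Fin 3 → ℝ :=
  let x := r / 9 * (a 1 - a 0)
  let y := r / 9 * (a 2 - a 0)
  let z := r / 9 * (a 2 - a 1)
  ![![0, 5 * x + 4 * y, 4 * x + 5 * y],
    ![5 * x + 4 * y, 10 * x + 5 * y, 6 * x + 6 * y],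
    ![4 * x + 5 * y, 6 * x + 6 * y, 5 * x + 10 * y],
    ![- 5 * x + 4 * z, 0, - 4 * x + 5 * z],
    ![- 10 * x + 5 * z, - 5 * x + 4 * z, - 6 * x + 6 * z],
    ![- 6 * x + 6 * z, - 4 * x + 5 * z, - 5 * x + 10 * z],
    ![- 5 * y - 4 * z, - 4 * y - 5 * z, 0],
    ![- 10 * y - 5 * z, - 6 * y - 6 * z, - 5 * y - 4 * z],
    ![- 6 * y - 6 * z, - 5 * y - 10 * z, - 4 * y - 5 * z]]

/-- Harmonic extension on side cells (mod constants). -/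
def HS (r : ℝ) (a : Fin 3 → ℝ) : Fin 3 → Fin 3 → ℝ :=
  let x := r / 3 * (a 1 - a 0)
  let y := r / 3 * (a 2 - a 0)
  let z := r / 3 * (a 2 - a 1)
  ![![0, 2 * x, x], ![0, y, 2 * y], ![z, 0, 2 * z]]

def HH (n : ℕ) (r : ℝ) (a : Fin 3 → ℝ) : Idx n → Fin 3 → ℝ :=
  Sum.elim (HC r a) (fun x => HS r a x.1)

theorem sum_Idx (n : ℕ) (f : Idx n → ℝ) : ∑ x, f x =
    (∑ i : Fin 9, f (Sum.inl i)) + ((∑ j : Fin (n + 1), f (Sum.inr (0, j))) +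
      (∑ j : Fin (n + 1), f (Sum.inr (1, j))) + ∑ j : Fin (n + 1), f (Sum.inr (2, j))) := by
  rw [Fintype.sum_sum_type, Fintype.sum_prod_type, Fin.sum_univ_three]

theorem telesc (n : ℕ) (c : ℝ) (F : ℕ → ℝ) :
    ∑ j : Fin (n + 1), c * (F (j + 1) - F j) = c * (F (n + 1) - F 0) := by
  rw [← Finset.mul_sum, Fin.sum_univ_eq_sum_range (fun j => F (j + 1) - F j),
    Finset.sum_range_sub]

theorem sum_TB (n : ℕ) (r : ℝ) (a : Fin 3 → ℝ) (U : ℕ × ℕ → ℝ)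
    (h0 : U (0, 0) = a 0) (h1 : U (n + 5, 0) = a 1) (h2 : U (0, n + 5) = a 2) :
    ∑ x, TB (HH n r a x) (cv U (phi n x)) = r * TQ a := by
  rw [sum_Idx]
  have s0 : ∀ j : Fin (n + 1), TB (HH n r a (Sum.inr (0, j))) (cv U (phi n (Sum.inr (0, j))))
      = r * (a 1 - a 0) * ((fun j => U (j + 2, 0)) (j + 1 : ℕ) - (fun j => U (j + 2, 0)) (j : ℕ)) := by
    intro j
    simp [TB, HH, HS, cv, phi, phiS]
    ring_nf
  have s1 : ∀ j : Fin (n + 1), TB (HH n r a (Sum.inr (1, j))) (cv U (phi n (Sum.inr (1, j))))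
      = r * (a 2 - a 0) * ((fun j => U (0, j + 2)) (j + 1 : ℕ) - (fun j => U (0, j + 2)) (j : ℕ)) := by
    intro j
    simp [TB, HH, HS, cv, phi, phiS]
    ring_nf
  have s2 : ∀ j : Fin (n + 1), TB (HH n r a (Sum.inr (2, j))) (cv U (phi n (Sum.inr (2, j))))
      = r * (a 2 - a 1) * ((fun j => U (n + 3 - j, j + 2)) (j + 1 : ℕ)
        - (fun j => U (n + 3 - j, j + 2)) (j : ℕ)) := by
    intro j
    have hj := j.2
    have e1 : n + 2 - (j : ℕ) + 1 = n + 3 - j := by omega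
    have e2 : n + 3 - ((j : ℕ) + 1) = n + 2 - j := by omega
    simp only [TB, HH, HS, cv, phi, phiS, e1, e2, Sum.elim_inr, Matrix.cons_val]
    ring_nf
  rw [Finset.sum_congr rfl (fun j _ => s0 j), Finset.sum_congr rfl (fun j _ => s1 j),
    Finset.sum_congr rfl (fun j _ => s2 j),
    telesc n _ (fun j => U (j + 2, 0)), telesc n _ (fun j => U (0, j + 2)),
    telesc n _ (fun j => U (n + 3 - j, j + 2))]
  have e3 : n + 3 - (n + 1) = 2 := by omega
  have e4 : n + 3 - 0 = n + 3 := by omega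
  simp only [Fin.sum_univ_succ (n := 8), Fin.sum_univ_eight, TB, HH, HC, phi, phiC, cv, Sum.elim_inl, TQ, ← h0, ← h1, ← h2, e3, e4]
  simp [Fin.succ]
  ring_nf

theorem sum_TQ_HH (n : ℕ) (a : Fin 3 → ℝ) :
    ∑ x, TQ (HH n (rl (n + 5)) a x) = rl (n + 5) * TQ a := by
  rw [sum_Idx]
  have hr : rl (n + 5) * (6 * n + 31) = 9 := by
    unfold rl; push_cast
    rw [inv_mul_eq_div, div_eq_iff (by positivity)]; ring
  generalize rl (n + 5) = r at hr
  simp only [Fin.sum_univ_succ (n := 8), Fin.sum_univ_eight, HH, HC, HS, Sum.elim_inl, Sum.elim_inr, TQ,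
    Finset.sum_const, Finset.card_univ, Fintype.card_fin, nsmul_eq_mul]
  simp [Fin.succ]
  linear_combination (r / 9 * ((a 0 - a 1) ^ 2 + (a 1 - a 2) ^ 2 + (a 0 - a 2) ^ 2)) * hr

theorem min_side (a : Fin 3 → ℝ) : 6 * (a 1 - a 0) ^ 2 ≤ TQ a ∨ 6 * (a 2 - a 0) ^ 2 ≤ TQ a
    ∨ 6 * (a 2 - a 1) ^ 2 ≤ TQ a := by
  unfold TQ
  generalize hx : a 1 - a 0 = x
  generalize hy : a 2 - a 0 = y
  have e : a 2 - a 1 = y - x := by rw [← hx, ← hy]; ring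
  have e1 : a 0 - a 1 = - x := by rw [← hx]; ring
  have e2 : a 1 - a 2 = x - y := by rw [← hx, ← hy]; ring
  have e3 : a 0 - a 2 = - y := by rw [← hy]; ring
  rw [e, e1, e2, e3]
  by_contra! h
  obtain ⟨h1, h2, h3⟩ := h
  have k1 : 0 < (2 * x - y) * (x + y) := by nlinarith
  have k2 : 0 < (2 * y - x) * (x + y) := by nlinarith
  have k3 : 0 < (2 * x - y) * (x - 2 * y) := by nlinarith
  nlinarith [mul_pos k1 k2, sq_nonneg (x + y)]

theorem cell_vals (q : Fin 3 → E2) (L : ℕ) (g : E2 → ℝ) (i : ℕ × ℕ) :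
    (g ∘ fmap q L i) ∘ q = cv (fun p => g (q 0 + ((p.1 : ℝ) / L) • (q 1 - q 0)
      + ((p.2 : ℝ) / L) • (q 2 - q 0))) i := by
  funext j
  fin_cases j
  · simp [cv, fmap]
  · simp only [Function.comp, cv, fmap, Fin.mk_one, Matrix.cons_val]
    congr 1
    push_cast
    module
  · simp only [Function.comp, cv, fmap, Fin.reduceFinMk, Matrix.cons_val]
    congr 1
    push_cast
    module

theorem rl_pos (l : ℕ) : 0 < rl l := by unfold rl; positivity

/-- Pythagoras: existence of the harmonic part. -/
theorem pyth (q : Fin 3 → E2) (n : ℕ) (g : E2 → ℝ) :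
    ∑ x, TQ ((g ∘ fmap q (n + 5) (phi n x)) ∘ q - HH n (rl (n + 5)) (g ∘ q) x)
      = ∑ x, TQ ((g ∘ fmap q (n + 5) (phi n x)) ∘ q) - rl (n + 5) * TQ (g ∘ q) := by
  have h5 : ((n + 5 : ℕ) : ℝ) ≠ 0 := by positivity
  have := sum_TB n (rl (n + 5)) (g ∘ q) (fun p => g (q 0 + ((p.1 : ℝ) / (n + 5 : ℕ)) • (q 1 - q 0)
      + ((p.2 : ℝ) / (n + 5 : ℕ)) • (q 2 - q 0))) (by simp)
      (by simp only [div_self h5]; simp) (by simp only [div_self h5]; simp)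
  simp only [← cell_vals q (n + 5)] at this
  simp only [TQ_sub, Finset.sum_add_distrib, Finset.sum_sub_distrib, ← Finset.mul_sum,
    this, sum_TQ_HH]
  ring

theorem local_mono (q : Fin 3 → E2) (L : ℕ) (hL : 5 ≤ L) (g : E2 → ℝ) :
    E0 q g g ≤ (rl L)⁻¹ * ∑ i ∈ Sf L, E0 q (g ∘ fmap q L i) (g ∘ fmap q L i) := by
  obtain ⟨n, rfl⟩ := Nat.exists_eq_add_of_le' hL
  rw [le_inv_mul_iff₀ (rl_pos _), sum_Sf]
  simp only [E0_eq]
  have := pyth q n g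
  have h2 : 0 ≤ ∑ x, TQ ((g ∘ fmap q (n + 5) (phi n x)) ∘ q - HH n (rl (n + 5)) (g ∘ q) x) :=
    Finset.sum_nonneg (fun _ _ => TQ_nonneg _)
  linarith

theorem HH_side (n : ℕ) (a : Fin 3 → ℝ) : ∃ s : Fin 3, ∀ j : Fin (n + 1),
    2 * (3 * n + 12) * TQ (HH n (rl (n + 5)) a (Sum.inr (s, j))) ≤ rl (n + 5) * TQ a := by
  have hr : rl (n + 5) * (6 * n + 31) = 9 := by
    unfold rl; push_cast
    rw [inv_mul_eq_div, div_eq_iff (by positivity)]; ring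
  have hp := rl_pos (n + 5)
  generalize rl (n + 5) = r at hr hp
  have key : ∀ d : ℝ, 6 * d ^ 2 ≤ TQ a →
      2 * (3 * n + 12) * (2 / 3 * (r * d) ^ 2) ≤ r * TQ a := by
    intro d hd
    have h1 : 2 * (3 * n + 12) * (2 / 3 * (r * d) ^ 2) ≤ r * (6 * d ^ 2) := by
      have : r * (6 * d ^ 2) - 2 * (3 * n + 12) * (2 / 3 * (r * d) ^ 2)
        = 14 / 3 * r ^ 2 * d ^ 2 := by linear_combination (- 2 / 3 * r * d ^ 2) * hr
      have h0 : 0 ≤ 14 / 3 * r ^ 2 * d ^ 2 := by positivity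
      linarith
    exact h1.trans (mul_le_mul_of_nonneg_left hd hp.le)
  rcases min_side a with h | h | h
  · refine ⟨0, fun j => le_trans (le_of_eq ?_) (key _ h)⟩
    simp only [HH, HS, TQ, Sum.elim_inr, Matrix.cons_val]; ring
  · refine ⟨1, fun j => le_trans (le_of_eq ?_) (key _ h)⟩
    simp only [HH, HS, TQ, Sum.elim_inr, Matrix.cons_val]; ring
  · refine ⟨2, fun j => le_trans (le_of_eq ?_) (key _ h)⟩
    simp only [HH, HS, TQ, Sum.elim_inr, Matrix.cons_val]; ring

/-- Cauchy-Schwarz for sums of square roots. -/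
theorem sum_sqrt_le {ι : Type*} (s : Finset ι) (f : ι → ℝ) (hf : ∀ i ∈ s, 0 ≤ f i) (M : ℝ)
    (hM : 0 < M) (hc : (s.card : ℝ) ≤ M) : ∑ i ∈ s, √(f i / M) ≤ √(∑ i ∈ s, f i) := by
  apply Real.le_sqrt_of_sq_le
  have h1 := sq_sum_le_card_mul_sum_sq (s := s) (f := fun i => √(f i / M))
  have h2 : ∑ i ∈ s, √(f i / M) ^ 2 = (∑ i ∈ s, f i) / M := by
    rw [Finset.sum_div]
    exact Finset.sum_congr rfl (fun i hi => Real.sq_sqrt (div_nonneg (hf i hi) hM.le))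
  rw [h2] at h1
  have h3 : 0 ≤ ∑ i ∈ s, f i := Finset.sum_nonneg hf
  calc _ ≤ _ := h1
    _ ≤ M * ((∑ i ∈ s, f i) / M) := by gcongr
    _ = _ := by field_simp

/-- The contraction of the Hellinger affinity for harmonic functions. -/
theorem harm_contr (n : ℕ) (a : Fin 3 → ℝ) :
    ∑ x, √(TQ (HH n (rl (n + 5)) a x) / (rl (n + 5)) / (3 * n + 12)) ≤ (383 / 384) * √(TQ a) := by
  have hsum := sum_TQ_HH n a
  have hp := rl_pos (n + 5)
  obtain ⟨s, hs⟩ := HH_side n a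
  have hM : (0 : ℝ) < 3 * n + 12 := by positivity
  generalize rl (n + 5) = r at *
  set η : Idx n → ℝ := fun x => TQ (HH n r a x) / r with hη
  have hη0 : ∀ x, 0 ≤ η x := fun x => div_nonneg (TQ_nonneg _) hp.le
  have hηs : ∑ x, η x = TQ a := by
    rw [hη, ← Finset.sum_div, hsum]; field_simp
  have hηJ : ∀ j : Fin (n + 1), 2 * (3 * n + 12) * η (Sum.inr (s, j)) ≤ TQ a := by
    intro j
    have := hs j
    rw [hη]
    simp only
    rw [← mul_div_assoc, div_le_iff₀ hp]; linarith
  change ∑ x, √(η x / (3 * n + 12)) ≤ _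
  have he := TQ_nonneg a
  generalize TQ a = e at *
  rcases he.eq_or_lt with he0 | hepos
  · have : ∀ x, η x = 0 := by
      intro x
      have := (Finset.sum_eq_zero_iff_of_nonneg (fun x _ => hη0 x)).1 (hηs.trans he0.symm)
      exact this x (Finset.mem_univ x)
    simp [this, ← he0]
  set t := √(e / (3 * n + 12)) with ht
  have ht2 : t ^ 2 = e / (3 * n + 12) := Real.sq_sqrt (by positivity)
  have ht0 : 0 ≤ t := Real.sqrt_nonneg _
  have hse : 0 < √e := Real.sqrt_pos.2 hepos
  have hmul : ∀ x, √(η x / (3 * n + 12)) * √e = √(η x) * t := by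
    intro x
    rw [ht, ← Real.sqrt_mul (by have := hη0 x; positivity), ← Real.sqrt_mul (hη0 x)]
    congr 1; ring
  have hb : ∀ x : Idx n, √(η x) * t ≤ (η x + t ^ 2) / 2
      - Sum.elim (fun _ => 0) (fun y : Fin 3 × Fin (n + 1) => if y.1 = s then t ^ 2 / 32 else 0) x := by
    intro x
    have hsq := Real.sq_sqrt (hη0 x)
    have hn := Real.sqrt_nonneg (η x)
    have gen : √(η x) * t ≤ (η x + t ^ 2) / 2 := by nlinarith [sq_nonneg (√(η x) - t)]
    rcases x with c | ⟨s', j⟩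
    · simpa using gen
    · simp only [Sum.elim_inr]
      split_ifs with hss
      · subst hss
        have h1 : 2 * η (Sum.inr (s', j)) ≤ t ^ 2 := by
          rw [ht2, le_div_iff₀ hM]; linarith [hηJ j]
        generalize √(η (Sum.inr (s', j))) = z at *
        have hz : z ≤ 3 / 4 * t := by
          by_contra! hcon
          nlinarith
        nlinarith
      · linarith
  have hsum2 : (∑ x, √(η x / (3 * n + 12))) * √e ≤ (383 / 384) * e := by
    rw [Finset.sum_mul]
    simp only [hmul]
    refine (Finset.sum_le_sum (fun x _ => hb x)).trans ?_
    have hD : ∑ x : Idx n, Sum.elim (fun _ => (0 : ℝ))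
        (fun y : Fin 3 × Fin (n + 1) => if y.1 = s then t ^ 2 / 32 else 0) x
        = (n + 1 : ℝ) * (t ^ 2 / 32) := by
      rw [Fintype.sum_sum_type, Fintype.sum_prod_type, Finset.sum_comm]
      simp
    have hE : ∑ _x : Idx n, t ^ 2 = ((9 : ℝ) + 3 * (n + 1)) * t ^ 2 := by
      simp
    rw [Finset.sum_sub_distrib, ← Finset.sum_div, Finset.sum_add_distrib, hηs, hD, hE, ht2]
    have e1 : ((9 : ℝ) + 3 * (n + 1)) * (e / (3 * n + 12)) = e := by field_simp; ring
    have e2 : e / 384 ≤ (n + 1 : ℝ) * (e / (3 * n + 12) / 32) := by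
      rw [div_div, ← mul_div_assoc, div_le_div_iff₀ (by norm_num) (by positivity)]
      have : 0 ≤ (n : ℝ) := n.cast_nonneg
      nlinarith [mul_nonneg this hepos.le]
    rw [e1]
    linarith
  have : (383 / 384) * e = (383 / 384 * √e) * √e := by
    rw [mul_assoc, Real.mul_self_sqrt he]
  rw [this] at hsum2
  exact le_of_mul_le_mul_right hsum2 hse

theorem local_contr (q : Fin 3 → E2) (L : ℕ) (hL : 5 ≤ L) (g : E2 → ℝ) :
    ∑ i ∈ Sf L, √(E0 q (g ∘ fmap q L i) (g ∘ fmap q L i) / (rl L) / ((3 * L - 3 : ℕ) : ℝ))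
      ≤ (383 / 384) * √(E0 q g g) +
        √((rl L)⁻¹ * (∑ i ∈ Sf L, E0 q (g ∘ fmap q L i) (g ∘ fmap q L i)) - E0 q g g) := by
  obtain ⟨n, rfl⟩ := Nat.exists_eq_add_of_le' hL
  rw [sum_Sf, sum_Sf]
  simp only [E0_eq]
  have hp := rl_pos (n + 5)
  have e : ((3 * (n + 5) - 3 : ℕ) : ℝ) = 3 * n + 12 := by
    rw [show 3 * (n + 5) - 3 = 3 * n + 12 by omega]; push_cast; ring
  rw [e]
  have hM : (0 : ℝ) < 3 * n + 12 := by positivity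
  have h1 : ∀ x : Idx n, √(TQ ((g ∘ fmap q (n + 5) (phi n x)) ∘ q) / rl (n + 5) / (3 * n + 12)) ≤
      √(TQ (HH n (rl (n + 5)) (g ∘ q) x) / rl (n + 5) / (3 * n + 12)) +
      √(TQ ((g ∘ fmap q (n + 5) (phi n x)) ∘ q - HH n (rl (n + 5)) (g ∘ q) x) / rl (n + 5)
        / (3 * n + 12)) := by
    intro x
    have := sqrt_TQ_le ((g ∘ fmap q (n + 5) (phi n x)) ∘ q) (HH n (rl (n + 5)) (g ∘ q) x)
    simp only [div_div, Real.sqrt_div (TQ_nonneg _)]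
    rw [← add_div]
    gcongr
  refine (Finset.sum_le_sum (fun x _ => h1 x)).trans ?_
  rw [Finset.sum_add_distrib]
  refine add_le_add (harm_contr n (g ∘ q)) ?_
  refine (sum_sqrt_le _ _ (fun x _ => div_nonneg (TQ_nonneg _) hp.le) _ hM ?_).trans (le_of_eq ?_)
  · simp; linarith
  · rw [← Finset.sum_div, pyth]
    congr 1
    field_simp

/-! ### Words -/

/-- Concatenation of words. -/
def cat (n : ℕ) (w v : ℕ → ℕ × ℕ) : ℕ → ℕ × ℕ := fun j => if j < n then w j else v (j - n)

theorem wordMap_congr (q : Fin 3 → E2) (l : ℕ → ℕ) (w v : ℕ → ℕ × ℕ) (n : ℕ)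
    (h : ∀ j < n, w j = v j) : wordMap q l w n = wordMap q l v n := by
  induction n with
  | zero => rfl
  | succ n ih =>
    simp only [wordMap]
    rw [ih (fun j hj => h j (by omega)), h n (by omega)]

theorem wordMap_cat (q : Fin 3 → E2) (l : ℕ → ℕ) (w v : ℕ → ℕ × ℕ) (n k : ℕ) :
    wordMap q l (cat n w v) (n + k) = wordMap q l w n ∘ wordMap q (fun j => l (j + n)) v k := by
  induction k with
  | zero =>
    simp only [wordMap, Function.comp_id, Nat.add_zero]
    exact wordMap_congr q l _ _ n (fun j hj => by simp [cat, hj])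
  | succ k ih =>
    rw [← Nat.add_assoc]
    simp only [wordMap]
    rw [ih, Function.comp_assoc]
    simp [cat, Nat.add_comm]

theorem Wn_finite (l : ℕ → ℕ) (n : ℕ) : (Wn l n).Finite := by
  induction n with
  | zero =>
    apply (Set.finite_singleton (fun _ : ℕ => ((0, 0) : ℕ × ℕ))).subset
    intro w hw
    exact funext (fun k => hw.2 k (Nat.zero_le k))
  | succ n ih =>
    apply ((ih.prod (Sset_finite (l n))).image
      (fun x : (ℕ → ℕ × ℕ) × (ℕ × ℕ) => Function.update x.1 n x.2)).subset
    intro w hw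
    refine ⟨(Function.update w n (0, 0), w n), ⟨⟨?_, ?_⟩, hw.1 n (by omega)⟩, ?_⟩
    · intro k hk
      change Function.update w n (0, 0) k ∈ Sset (l k)
      rw [Function.update_of_ne (by omega)]
      exact hw.1 k (by omega)
    · intro k hk
      change Function.update w n (0, 0) k = (0, 0)
      by_cases h : k = n
      · subst h; simp
      · rw [Function.update_of_ne h]; exact hw.2 k (by omega)
    · simp

/-- The words of length `n` as a finset. -/
def Wf (l : ℕ → ℕ) (n : ℕ) : Finset (ℕ → ℕ × ℕ) := (Wn_finite l n).toFinset

theorem mem_Wf {l : ℕ → ℕ} {n : ℕ} {w : ℕ → ℕ × ℕ} : w ∈ Wf l n ↔ w ∈ Wn l n := by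
  simp [Wf]

theorem mem_Sf {l : ℕ} {p : ℕ × ℕ} : p ∈ Sf l ↔ p ∈ Sset l := by
  simp [Sf]

theorem sum_Wf_add (l : ℕ → ℕ) (n k : ℕ) (f : (ℕ → ℕ × ℕ) → ℝ) :
    ∑ w ∈ Wf l (n + k), f w = ∑ w ∈ Wf l n, ∑ v ∈ Wf (fun j => l (j + n)) k, f (cat n w v) := by
  rw [← Finset.sum_product']
  symm
  refine Finset.sum_bij' (fun x _ => cat n x.1 x.2)
    (fun w _ => (fun j => if j < n then w j else (0, 0), fun j => w (j + n))) ?_ ?_ ?_ ?_ ?_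
  · rintro ⟨w, v⟩ h
    simp only [Finset.mem_product, mem_Wf] at h ⊢
    obtain ⟨hw, hv⟩ := h
    constructor
    · intro j hj
      simp only [cat]
      split_ifs with hjn
      · exact hw.1 j hjn
      · have := hv.1 (j - n) (by omega)
        simpa [Nat.sub_add_cancel (not_lt.1 hjn)] using this
    · intro j hj
      simp only [cat]
      rw [if_neg (by omega)]
      exact hv.2 _ (by omega)
  · intro w h
    simp only [Finset.mem_product, mem_Wf] at h ⊢
    refine ⟨⟨?_, ?_⟩, ?_, ?_⟩
    · intro j hj
      simp only [hj, if_true]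
      exact h.1 j (by omega)
    · intro j hj
      simp [not_lt.2 hj]
    · intro j hj
      exact h.1 (j + n) (by omega)
    · intro j hj
      exact h.2 (j + n) (by omega)
  · rintro ⟨w, v⟩ h
    simp only [Finset.mem_product, mem_Wf] at h
    obtain ⟨hw, hv⟩ := h
    apply Prod.ext
    · funext j
      simp only [cat]
      split_ifs with hj
      · rfl
      · exact (hw.2 j (not_lt.1 hj)).symm
    · funext j
      simp [cat]
  · intro w h
    funext j
    simp only [cat]
    split_ifs with hj
    · rfl
    · rw [Nat.sub_add_cancel (not_lt.1 hj)]
  · intro x h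
    rfl

theorem sum_Wf_one (l : ℕ → ℕ) (f : ℕ × ℕ → ℝ) :
    ∑ w ∈ Wf l 1, f (w 0) = ∑ i ∈ Sf (l 0), f i := by
  refine Finset.sum_bij' (fun w _ => w 0) (fun i _ => fun j => if j = 0 then i else (0, 0))
    ?_ ?_ ?_ ?_ ?_
  · intro w hw
    exact mem_Sf.2 ((mem_Wf.1 hw).1 0 (by omega))
  · intro i hi
    rw [mem_Wf]
    refine ⟨fun j hj => ?_, fun j hj => ?_⟩
    · have : j = 0 := by omega
      subst this
      simpa using mem_Sf.1 hi
    · simp only; rw [if_neg (by omega)]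
  · intro w hw
    funext j
    by_cases hj : j = 0
    · simp [hj]
    · simp only [hj, if_false]
      exact ((mem_Wf.1 hw).2 j (by omega)).symm
  · intro i hi
    simp
  · intro w hw
    rfl

theorem Wf_zero (l : ℕ → ℕ) : Wf l 0 = {fun _ => (0, 0)} := by
  ext w
  rw [mem_Wf, Finset.mem_singleton]
  constructor
  · intro hw
    exact funext (fun k => hw.2 k (Nat.zero_le k))
  · rintro rfl
    exact ⟨fun k hk => by omega, fun k _ => rfl⟩

theorem card_Wf (l : ℕ → ℕ) (hl : ∀ n, 5 ≤ l n) (n : ℕ) : ((Wf l n).card : ℝ) = Mn l n := by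
  induction n with
  | zero => simp [Wf_zero, Mn]
  | succ n ih =>
    have h1 := sum_Wf_add l n 1 (fun _ => 1)
    have h2 := sum_Wf_one (fun j => l (j + n)) (fun _ => 1)
    rw [h2] at h1
    simp only [Finset.sum_const, nsmul_eq_mul, mul_one, zero_add] at h1
    rw [h1, ih, card_Sf _ (hl n), Mn, Mn, Finset.prod_range_succ]
    push_cast
    ring

theorem Mn_pos (l : ℕ → ℕ) (hl : ∀ n, 5 ≤ l n) (n : ℕ) : 0 < Mn l n :=
  Finset.prod_pos (fun k _ => by have := hl k; omega)

theorem Rn_pos (l : ℕ → ℕ) (n : ℕ) : 0 < Rn l n := Finset.prod_pos (fun _ _ => rl_pos _)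

theorem Rn_add (l : ℕ → ℕ) (n k : ℕ) : Rn l (n + k) = Rn l n * Rn (fun j => l (j + n)) k := by
  simp only [Rn, Finset.prod_range_add, Nat.add_comm]

/-! ### Energies -/

theorem En_eq (q : Fin 3 → E2) (l : ℕ → ℕ) (n : ℕ) (g : E2 → ℝ) : En q l n g g =
    (Rn l n)⁻¹ * ∑ w ∈ Wf l n, E0 q (g ∘ wordMap q l w n) (g ∘ wordMap q l w n) := by
  rw [En, finsum_mem_eq_finite_toFinset_sum _ (Wn_finite l n)]
  rfl

theorem E0_nonneg (q : Fin 3 → E2) (g : E2 → ℝ) : 0 ≤ E0 q g g := by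
  rw [E0_eq]; exact TQ_nonneg _

theorem En_nonneg (q : Fin 3 → E2) (l : ℕ → ℕ) (n : ℕ) (g : E2 → ℝ) : 0 ≤ En q l n g g := by
  rw [En_eq]
  have := Rn_pos l n
  have := Finset.sum_nonneg (s := Wf l n)
    (fun w _ => E0_nonneg q (g ∘ wordMap q l w n))
  positivity

theorem En_zero (q : Fin 3 → E2) (l : ℕ → ℕ) (g : E2 → ℝ) : En q l 0 g g = E0 q g g := by
  rw [En_eq, Wf_zero]
  simp [Rn, wordMap]

theorem En_one (q : Fin 3 → E2) (l : ℕ → ℕ) (g : E2 → ℝ) : En q l 1 g g =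
    (rl (l 0))⁻¹ * ∑ i ∈ Sf (l 0), E0 q (g ∘ fmap q (l 0) i) (g ∘ fmap q (l 0) i) := by
  rw [En_eq, ← sum_Wf_one]
  simp [Rn, wordMap]

theorem En_add (q : Fin 3 → E2) (l : ℕ → ℕ) (n k : ℕ) (g : E2 → ℝ) : En q l (n + k) g g =
    ∑ w ∈ Wf l n, (Rn l n)⁻¹ *
      En q (fun j => l (j + n)) k (g ∘ wordMap q l w n) (g ∘ wordMap q l w n) := by
  rw [En_eq, sum_Wf_add, Rn_add, mul_inv, Finset.mul_sum]
  refine Finset.sum_congr rfl (fun w _ => ?_)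
  rw [En_eq, mul_assoc]
  simp only [wordMap_cat, Function.comp_assoc]

theorem En_mono (q : Fin 3 → E2) (l : ℕ → ℕ) (hl : ∀ n, 5 ≤ l n) (g : E2 → ℝ) :
    Monotone (fun n => En q l n g g) := by
  apply monotone_nat_of_le_succ
  intro n
  have h0 := En_add q l n 0 g
  have h1 := En_add q l n 1 g
  rw [Nat.add_zero] at h0
  rw [h0, h1]
  refine Finset.sum_le_sum (fun w _ => ?_)
  have := Rn_pos l n
  refine mul_le_mul_of_nonneg_left ?_ (by positivity)
  rw [En_zero, En_one]
  exact local_mono q _ (hl _) _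

/-- The level-`n` Hellinger affinity. -/
def Hel (q : Fin 3 → E2) (l : ℕ → ℕ) (u : E2 → ℝ) (n : ℕ) : ℝ :=
  ∑ w ∈ Wf l n, √((Rn l n)⁻¹ * E0 q (u ∘ wordMap q l w n) (u ∘ wordMap q l w n) / Mn l n)

theorem Hel_step (q : Fin 3 → E2) (l : ℕ → ℕ) (hl : ∀ n, 5 ≤ l n) (u : E2 → ℝ) (n : ℕ) :
    Hel q l u (n + 1) ≤ (383 / 384) * Hel q l u n + √(En q l (n + 1) u u - En q l n u u) := by
  have hR := Rn_pos l n
  have hM : (0 : ℝ) < Mn l n := by exact_mod_cast Mn_pos l hl n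
  have hr := rl_pos (l n)
  set δ : (ℕ → ℕ × ℕ) → ℝ := fun w => (rl (l n))⁻¹ *
    (∑ i ∈ Sf (l n), E0 q ((u ∘ wordMap q l w n) ∘ fmap q (l n) i)
      ((u ∘ wordMap q l w n) ∘ fmap q (l n) i)) - E0 q (u ∘ wordMap q l w n) (u ∘ wordMap q l w n)
    with hδ
  have hδ0 : ∀ w, 0 ≤ δ w := fun w => sub_nonneg.2 (local_mono q _ (hl n) _)
  have hD : En q l (n + 1) u u - En q l n u u = ∑ w ∈ Wf l n, (Rn l n)⁻¹ * δ w := by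
    rw [En_add q l n 1 u, En_eq q l n u, Finset.mul_sum, ← Finset.sum_sub_distrib]
    refine Finset.sum_congr rfl (fun w _ => ?_)
    rw [En_one, hδ]
    simp only [zero_add]
    ring
  have h1 : Hel q l u (n + 1) = ∑ w ∈ Wf l n, √((Rn l n)⁻¹ / Mn l n) * ∑ i ∈ Sf (l n),
      √(E0 q ((u ∘ wordMap q l w n) ∘ fmap q (l n) i) ((u ∘ wordMap q l w n) ∘ fmap q (l n) i)
        / rl (l n) / ((3 * l n - 3 : ℕ) : ℝ)) := by
    rw [Hel, sum_Wf_add]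
    refine Finset.sum_congr rfl (fun w _ => ?_)
    have := sum_Wf_one (fun j => l (j + n)) (fun i =>
      √(E0 q ((u ∘ wordMap q l w n) ∘ fmap q (l n) i) ((u ∘ wordMap q l w n) ∘ fmap q (l n) i)
        / rl (l n) / ((3 * l n - 3 : ℕ) : ℝ)))
    simp only [zero_add] at this
    rw [← this, Finset.mul_sum]
    refine Finset.sum_congr rfl (fun v _ => ?_)
    rw [← Real.sqrt_mul (by positivity)]
    congr 1
    have e1 : wordMap q (fun j => l (j + n)) v 1 = fmap q (l n) (v 0) := by
      simp [wordMap]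
    rw [wordMap_cat, e1, ← Function.comp_assoc]
    have e2 : Rn l (n + 1) = Rn l n * rl (l n) := by simp [Rn, Finset.prod_range_succ]
    have e3 : (Mn l (n + 1) : ℝ) = Mn l n * ((3 * l n - 3 : ℕ) : ℝ) := by
      rw [Mn, Finset.prod_range_succ, ← Mn]; push_cast; ring
    rw [e2, e3]
    simp only [div_eq_mul_inv, mul_inv]
    ring
  have h2 : ∀ w ∈ Wf l n, √((Rn l n)⁻¹ / Mn l n) * ∑ i ∈ Sf (l n),
      √(E0 q ((u ∘ wordMap q l w n) ∘ fmap q (l n) i) ((u ∘ wordMap q l w n) ∘ fmap q (l n) i)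
        / rl (l n) / ((3 * l n - 3 : ℕ) : ℝ)) ≤
      (383 / 384) * √((Rn l n)⁻¹ * E0 q (u ∘ wordMap q l w n) (u ∘ wordMap q l w n) / Mn l n)
      + √((Rn l n)⁻¹ * δ w / Mn l n) := by
    intro w _
    refine (mul_le_mul_of_nonneg_left (local_contr q (l n) (hl n) (u ∘ wordMap q l w n))
      (Real.sqrt_nonneg _)).trans (le_of_eq ?_)
    rw [mul_add, mul_left_comm, ← Real.sqrt_mul (by positivity), ← Real.sqrt_mul (by positivity)]
    congr 2
    · congr 1; ring
    · simp only [hδ]; ring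
  rw [h1, hD]
  refine (Finset.sum_le_sum h2).trans ?_
  rw [Finset.sum_add_distrib, ← Finset.mul_sum]
  refine add_le_add le_rfl ?_
  exact sum_sqrt_le _ _ (fun w _ => mul_nonneg (by positivity) (hδ0 w)) _ hM (card_Wf l hl n).le

theorem contr_tendsto (c : ℝ) (hc0 : 0 ≤ c) (hc1 : c < 1) (H d : ℕ → ℝ) (hH : ∀ n, 0 ≤ H n)
    (hd : Tendsto d atTop (nhds 0)) (hs : ∀ n, H (n + 1) ≤ c * H n + d n) :
    Tendsto H atTop (nhds 0) := by
  rw [Metric.tendsto_atTop]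
  intro ε hε
  have hlt : 0 < (1 - c) * (ε / 2) := mul_pos (by linarith) (by linarith)
  obtain ⟨N, hN⟩ := (Metric.tendsto_atTop.1 hd) _ hlt
  have h1 : ∀ k, H (N + k) ≤ c ^ k * H N + ε / 2 := by
    intro k
    induction k with
    | zero => simp; linarith
    | succ k ih =>
      have h2 := hs (N + k)
      have h3 := hN (N + k) (by omega)
      rw [Real.dist_eq, sub_zero] at h3
      have h4 := (abs_lt.1 h3).2
      have h5 := mul_le_mul_of_nonneg_left ih hc0
      rw [← Nat.add_assoc, pow_succ]
      nlinarith
  have h6 : Tendsto (fun k => c ^ k * H N) atTop (nhds (0 * H N)) :=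
    (tendsto_pow_atTop_nhds_zero_of_lt_one hc0 hc1).mul_const _
  rw [zero_mul] at h6
  obtain ⟨K, hK⟩ := (Metric.tendsto_atTop.1 h6) (ε / 2) (by linarith)
  refine ⟨N + K, fun n hn => ?_⟩
  obtain ⟨k, rfl⟩ := Nat.exists_eq_add_of_le (show N ≤ n by omega)
  have h7 := hK k (by omega)
  rw [Real.dist_eq, sub_zero] at h7 ⊢
  rw [abs_of_nonneg (hH _)]
  have := h1 k
  have := (abs_lt.1 h7).2
  linarith

theorem Hel_nonneg (q : Fin 3 → E2) (l : ℕ → ℕ) (u : E2 → ℝ) (n : ℕ) : 0 ≤ Hel q l u n :=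
  Finset.sum_nonneg (fun _ _ => Real.sqrt_nonneg _)

theorem Hel_tendsto (q : Fin 3 → E2) (l : ℕ → ℕ) (hl : ∀ n, 5 ≤ l n) (u : E2 → ℝ) (e : ℝ)
    (he : Tendsto (fun n => En q l n u u) atTop (nhds e)) :
    Tendsto (Hel q l u) atTop (nhds 0) := by
  refine contr_tendsto (383 / 384) (by norm_num) (by norm_num) _ _ (Hel_nonneg q l u) ?_
    (Hel_step q l hl u)
  have h1 := ((tendsto_add_atTop_iff_nat 1).2 he).sub he
  rw [sub_self] at h1
  simpa using h1.sqrt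

theorem En_tendsto (q : Fin 3 → E2) (l : ℕ → ℕ) (hl : ∀ n, 5 ≤ l n) (u : E2 → ℝ) (C : ℝ)
    (hC : ∀ n, En q l n u u ≤ C) : Tendsto (fun n => En q l n u u) atTop (nhds (EForm q l u u)) := by
  have h := tendsto_atTop_ciSup (En_mono q l hl u) ⟨C, by rintro _ ⟨n, rfl⟩; exact hC n⟩
  exact tendsto_nhds_limUnder ⟨_, h⟩

theorem cell_bdd (q : Fin 3 → E2) (l : ℕ → ℕ) (u : E2 → ℝ) (C : ℝ)
    (hC : ∀ n, En q l n u u ≤ C) (n : ℕ) (w : ℕ → ℕ × ℕ) (hw : w ∈ Wf l n) (k : ℕ) :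
    En q (fun j => l (j + n)) k (u ∘ wordMap q l w n) (u ∘ wordMap q l w n) ≤ Rn l n * C := by
  have hR := Rn_pos l n
  have h := hC (n + k)
  rw [En_add] at h
  rw [← inv_mul_le_iff₀ hR]
  refine le_trans ?_ h
  exact Finset.single_le_sum (f := fun w => (Rn l n)⁻¹ *
      En q (fun j => l (j + n)) k (u ∘ wordMap q l w n) (u ∘ wordMap q l w n))
    (fun w _ => mul_nonneg (by positivity) (En_nonneg _ _ _ _)) hw

theorem cell_ge (q : Fin 3 → E2) (l : ℕ → ℕ) (hl : ∀ n, 5 ≤ l n) (u : E2 → ℝ) (C : ℝ)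
    (hC : ∀ n, En q l n u u ≤ C) (n : ℕ) (w : ℕ → ℕ × ℕ) (hw : w ∈ Wf l n) :
    E0 q (u ∘ wordMap q l w n) (u ∘ wordMap q l w n) ≤
      EForm q (fun j => l (j + n)) (u ∘ wordMap q l w n) (u ∘ wordMap q l w n) := by
  have ht := En_tendsto q (fun j => l (j + n)) (fun j => hl _) (u ∘ wordMap q l w n) _
    (cell_bdd q l u C hC n w hw)
  have := (En_mono q (fun j => l (j + n)) (fun j => hl _) (u ∘ wordMap q l w n)).ge_of_tendsto ht 0
  simpa only [En_zero] using this

theorem cell_sum (q : Fin 3 → E2) (l : ℕ → ℕ) (hl : ∀ n, 5 ≤ l n) (u : E2 → ℝ) (C : ℝ)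
    (hC : ∀ n, En q l n u u ≤ C) (n : ℕ) :
    ∑ w ∈ Wf l n, (Rn l n)⁻¹ * EForm q (fun j => l (j + n)) (u ∘ wordMap q l w n)
      (u ∘ wordMap q l w n) = EForm q l u u := by
  have h1 : Tendsto (fun k => En q l (n + k) u u) atTop (nhds (EForm q l u u)) := by
    have := (tendsto_add_atTop_iff_nat n).2 (En_tendsto q l hl u C hC)
    simpa only [Nat.add_comm] using this
  refine tendsto_nhds_unique ?_ h1
  simp only [En_add]
  refine tendsto_finsetSum _ (fun w hw => ?_)
  exact (En_tendsto q (fun j => l (j + n)) (fun j => hl _) (u ∘ wordMap q l w n) _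
    (cell_bdd q l u C hC n w hw)).const_mul _

/-! ### Measures -/

theorem wordMap_cont (q : Fin 3 → E2) (l : ℕ → ℕ) (w : ℕ → ℕ × ℕ) (n : ℕ) :
    Continuous (wordMap q l w n) := by
  induction n with
  | zero => exact continuous_id
  | succ n ih =>
    refine ih.comp ?_
    unfold fmap
    fun_prop

theorem img_closed (q : Fin 3 → E2) (l : ℕ → ℕ) (w : ℕ → ℕ × ℕ) (n : ℕ) :
    IsClosed (wordMap q l w n '' Tri q) :=
  (((Set.finite_range q).isCompact_convexHull ℝ).image (wordMap_cont q l w n)).isClosed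

theorem gasket_closed (q : Fin 3 → E2) (l : ℕ → ℕ) : IsClosed (Gasket q l) :=
  isClosed_iInter (fun n => (Wn_finite l n).isClosed_biUnion (fun w _ => img_closed q l w n))

theorem cell_meas (q : Fin 3 → E2) (l : ℕ → ℕ) (n : ℕ) (w : ℕ → ℕ × ℕ) :
    MeasurableSet (Cell q l n w) :=
  ((gasket_closed q l).inter (img_closed q l w n)).measurableSet

theorem gasket_cover (q : Fin 3 → E2) (l : ℕ → ℕ) (n : ℕ) (x : E2) (hx : x ∈ Gasket q l) :
    ∃ w ∈ Wf l n, x ∈ Cell q l n w := by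
  have h := Set.mem_iInter.1 hx n
  simp only [Set.mem_iUnion] at h
  obtain ⟨w, hw, hxw⟩ := h
  exact ⟨w, mem_Wf.2 hw, hx, hxw⟩

/-- Level-`n` approximation: a set nearly `μ`-null and nearly of full `m`-measure. -/
theorem level_set (q : Fin 3 → E2) (l : ℕ → ℕ) (hl : ∀ n, 5 ≤ l n) (u : E2 → ℝ) (C : ℝ)
    (hC : ∀ n, En q l n u u ≤ C)
    (μ : Measure E2) (hμ : IsEnergyMeasure q l u μ)
    (m : Measure E2) (hm : IsUnif q l m) (n : ℕ) :
    ∃ A : Set E2, MeasurableSet A ∧ A ⊆ Gasket q l ∧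
      μ A ≤ ENNReal.ofReal (Hel q l u n + (EForm q l u u - En q l n u u)) ∧
      m (Gasket q l \ A) ≤ ENNReal.ofReal (Hel q l u n + (EForm q l u u - En q l n u u)) := by
  classical
  have hR := Rn_pos l n
  have hM : (0 : ℝ) < Mn l n := by exact_mod_cast Mn_pos l hl n
  set e : (ℕ → ℕ × ℕ) → ℝ := fun w =>
    (Rn l n)⁻¹ * E0 q (u ∘ wordMap q l w n) (u ∘ wordMap q l w n) with he
  set ν : (ℕ → ℕ × ℕ) → ℝ := fun w =>
    (Rn l n)⁻¹ * EForm q (fun j => l (j + n)) (u ∘ wordMap q l w n) (u ∘ wordMap q l w n) with hν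
  have he0 : ∀ w, 0 ≤ e w := fun w => mul_nonneg (by positivity) (E0_nonneg _ _)
  have hev : ∀ w ∈ Wf l n, e w ≤ ν w := fun w hw =>
    mul_le_mul_of_nonneg_left (cell_ge q l hl u C hC n w hw) (by positivity)
  have hν0 : ∀ w ∈ Wf l n, 0 ≤ ν w := fun w hw => (he0 w).trans (hev w hw)
  have hHel : Hel q l u n = ∑ w ∈ Wf l n, √(e w / Mn l n) := rfl
  have hEn : En q l n u u = ∑ w ∈ Wf l n, e w := by rw [En_eq, Finset.mul_sum]
  have hEf : EForm q l u u = ∑ w ∈ Wf l n, ν w := (cell_sum q l hl u C hC n).symm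
  have hdiff : 0 ≤ EForm q l u u - En q l n u u := by
    rw [hEf, hEn]; exact sub_nonneg.2 (Finset.sum_le_sum hev)
  refine ⟨⋃ w ∈ (Wf l n).filter (fun w => e w ≤ (Mn l n : ℝ)⁻¹), Cell q l n w, ?_, ?_, ?_, ?_⟩
  · exact Finset.measurableSet_biUnion _ (fun w _ => cell_meas q l n w)
  · exact Set.iUnion₂_subset (fun w _ => Set.inter_subset_left)
  · refine (measure_biUnion_finset_le _ _).trans ?_
    have h1 : ∀ w ∈ (Wf l n).filter (fun w => e w ≤ (Mn l n : ℝ)⁻¹),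
        μ (Cell q l n w) = ENNReal.ofReal (ν w) := by
      intro w hw
      exact hμ.2 n w (mem_Wf.1 (Finset.mem_filter.1 hw).1)
    rw [Finset.sum_congr rfl h1, ← ENNReal.ofReal_sum_of_nonneg
      (fun w hw => hν0 w (Finset.mem_filter.1 hw).1)]
    apply ENNReal.ofReal_le_ofReal
    rw [hHel, hEf, hEn, ← Finset.sum_sub_distrib, ← Finset.sum_add_distrib]
    refine le_trans (Finset.sum_le_sum (g := fun w => √(e w / Mn l n) + (ν w - e w)) ?_)
      (Finset.sum_le_sum_of_subset_of_nonneg (Finset.filter_subset _ _) ?_)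
    · intro w hw
      have h2 := (Finset.mem_filter.1 hw).2
      have : e w ≤ √(e w / Mn l n) := by
        apply Real.le_sqrt_of_sq_le
        rw [sq, div_eq_mul_inv]
        exact mul_le_mul_of_nonneg_left h2 (he0 w)
      linarith
    · intro w hw _
      have := hev w hw
      have := Real.sqrt_nonneg (e w / Mn l n)
      linarith
  · have hsub : Gasket q l \ (⋃ w ∈ (Wf l n).filter (fun w => e w ≤ (Mn l n : ℝ)⁻¹), Cell q l n w) ⊆
        ⋃ w ∈ (Wf l n).filter (fun w => ¬ e w ≤ (Mn l n : ℝ)⁻¹), Cell q l n w := by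
      rintro x ⟨hx, hxn⟩
      obtain ⟨w, hw, hxw⟩ := gasket_cover q l n x hx
      refine Set.mem_biUnion (x := w) ?_ hxw
      refine Finset.mem_coe.2 (Finset.mem_filter.2 ⟨hw, fun hle => hxn ?_⟩)
      exact Set.mem_biUnion (x := w) (Finset.mem_coe.2 (Finset.mem_filter.2 ⟨hw, hle⟩)) hxw
    refine (measure_mono hsub).trans ((measure_biUnion_finset_le _ _).trans ?_)
    have h1 : ∀ w ∈ (Wf l n).filter (fun w => ¬ e w ≤ (Mn l n : ℝ)⁻¹),
        m (Cell q l n w) = ENNReal.ofReal ((Mn l n : ℝ)⁻¹) := by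
      intro w hw
      rw [hm.2 n w (mem_Wf.1 (Finset.mem_filter.1 hw).1), ENNReal.ofReal_inv_of_pos hM,
        ENNReal.ofReal_natCast]
    rw [Finset.sum_congr rfl h1, ← ENNReal.ofReal_sum_of_nonneg (fun w _ => by positivity)]
    apply ENNReal.ofReal_le_ofReal
    refine le_trans ?_ (le_add_of_nonneg_right hdiff)
    rw [hHel]
    refine le_trans (Finset.sum_le_sum (g := fun w => √(e w / Mn l n)) ?_)
      (Finset.sum_le_sum_of_subset_of_nonneg (Finset.filter_subset _ _)
        (fun w _ _ => Real.sqrt_nonneg _))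
    intro w hw
    have h2 := (not_le.1 (Finset.mem_filter.1 hw).2).le
    apply Real.le_sqrt_of_sq_le
    rw [sq, div_eq_mul_inv]
    exact mul_le_mul_of_nonneg_right h2 (by positivity)

/-- The energy measure `μ` of any `u ∈ F` is singular with respect to
the uniform distribution `m` on `K`. -/
theorem stmt15 (q : Fin 3 → E2) (hq : ∀ j k : Fin 3, j ≠ k → dist (q j) (q k) = 1)
    (l : ℕ → ℕ) (hl : ∀ n, 5 ≤ l n) (u : E2 → ℝ) (hu : u ∈ FDom q l)
    (μ : Measure E2) (hμ : IsEnergyMeasure q l u μ)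
    (m : Measure E2) (hm : IsUnif q l m) :
    ∃ A : Set E2, MeasurableSet A ∧ A ⊆ Gasket q l ∧ μ A = 0 ∧
      m (Gasket q l \ A) = 0 := by
  obtain ⟨C, hC⟩ := hu
  have hE := En_tendsto q l hl u C hC
  have hb : Tendsto (fun n => Hel q l u n + (EForm q l u u - En q l n u u)) atTop (nhds 0) := by
    have h1 := (Hel_tendsto q l hl u _ hE).add (hE.const_sub (EForm q l u u))
    simpa using h1
  choose B hBm hBs hBμ hBν using level_set q l hl u C hC μ hμ m hm
  obtain ⟨φ, -, hφ⟩ := extraction_forall_of_eventually'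
    (P := fun k n => Hel q l u n + (EForm q l u u - En q l n u u) ≤ (1 / 2 : ℝ) ^ k)
    (fun k => (hb.eventually_le_const (show (0 : ℝ) < (1 / 2) ^ k by positivity)).exists_forall_of_atTop)
  have hμk : ∀ k, μ (B (φ k)) ≤ ENNReal.ofReal ((1 / 2 : ℝ) ^ k) := fun k =>
    (hBμ (φ k)).trans (ENNReal.ofReal_le_ofReal (hφ k))
  have hmk : ∀ k, m (Gasket q l \ B (φ k)) ≤ ENNReal.ofReal ((1 / 2 : ℝ) ^ k) := fun k =>
    (hBν (φ k)).trans (ENNReal.ofReal_le_ofReal (hφ k))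
  refine ⟨limsup (fun k => B (φ k)) atTop, MeasurableSet.measurableSet_limsup (fun k => hBm _),
    ?_, ?_, ?_⟩
  · intro x hx
    rw [mem_limsup_iff_frequently_mem] at hx
    obtain ⟨k, hk⟩ := hx.exists
    exact hBs _ hk
  · apply measure_limsup_atTop_eq_zero
    refine ne_top_of_le_ne_top ?_ (ENNReal.tsum_le_tsum hμk)
    rw [← ENNReal.ofReal_tsum_of_nonneg (fun k => by positivity) summable_geometric_two]
    exact ENNReal.ofReal_ne_top
  · have hsub : Gasket q l \ limsup (fun k => B (φ k)) atTop ⊆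
        ⋃ j : ℕ, ⋂ k ≥ j, (Gasket q l \ B (φ k)) := by
      rintro x ⟨hx, hxn⟩
      rw [mem_limsup_iff_frequently_mem, not_frequently] at hxn
      obtain ⟨j, hj⟩ := eventually_atTop.1 hxn
      exact Set.mem_iUnion.2 ⟨j, Set.mem_iInter₂.2 (fun k hk => ⟨hx, hj k hk⟩)⟩
    refine measure_mono_null hsub (measure_iUnion_null (fun j => ?_))
    have ht : Tendsto (fun k : ℕ => ENNReal.ofReal ((1 / 2 : ℝ) ^ k)) atTop (nhds 0) := by
      have := ENNReal.tendsto_ofReal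
        (tendsto_pow_atTop_nhds_zero_of_lt_one (r := (1 / 2 : ℝ)) (by norm_num) (by norm_num))
      simpa using this
    refine le_antisymm (ge_of_tendsto ht (eventually_atTop.2 ⟨j, fun k hk => ?_⟩)) bot_le
    exact (measure_mono (Set.iInter₂_subset k hk)).trans (hmk k)
end
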